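/- arXiv:1905.01083 — 3 statements merged into one kernel-verified Lean document; each statement's English description precedes it below -/
import Mathlib

section
/- Let ν be a finite signed measure on ℝ such that |ν({a})| < 1 for every a ∈ ℝ, and let f_ν be the associated function. Then f_ν is right continuous at every point of ℝ. -/
open MeasureTheory
open scoped ENNReal NNReal

/-- The Wasserstein distance of order `p` between two measures on a (pseudo-e)metric space:
the infimum over all couplings `π` of `μ` and `ν` of `(∫ d(x,y)^p dπ)^(1/p)`. -/
noncomputable def wassersteinDist {E : Type*} [PseudoEMetricSpace E] [MeasurableSpace E]
    (p : ℝ) (μ ν : Measure E) : ℝ≥0∞ :=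
  ⨅ π ∈ {π : Measure (E × E) | π.map Prod.fst = μ ∧ π.map Prod.snd = ν},
    (∫⁻ z, edist z.1 z.2 ^ p ∂π) ^ (1 / p)

open Classical in
/-- The relative entropy `H(ν|μ) = ∫ log (dν/dμ) dν` if `ν ≪ μ` (and the integral exists),
and `+∞` otherwise. -/
noncomputable def relEntropy {E : Type*} [MeasurableSpace E] (ν μ : Measure E) : ℝ≥0∞ :=
  if ν ≪ μ ∧ Integrable (fun x => Real.log (ν.rnDeriv μ x).toReal) ν then
    ENNReal.ofReal (∫ x, Real.log (ν.rnDeriv μ x).toReal ∂ν)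
  else ⊤

/-- A probability measure `μ` satisfies the transportation inequality `T_p(C)` if
`W_p(μ,ν) ≤ √(2 C H(ν|μ))` for every probability measure `ν`. -/
def SatisfiesTp {E : Type*} [PseudoEMetricSpace E] [MeasurableSpace E]
    (p C : ℝ) (μ : Measure E) : Prop :=
  ∀ ν : Measure E, IsProbabilityMeasure ν →
    wassersteinDist p μ ν ≤ (ENNReal.ofReal (2 * C) * relEntropy ν μ) ^ (1 / 2 : ℝ)

/-- The function `f_ν` associated to a finite signed measure `ν` on `ℝ`:
`f_ν(x) = exp(−2 ν^c((−∞,x])) ∏_{y atom of ν, y ≤ x} (1−ν({y}))/(1+ν({y}))`,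
where `ν^c(A) = ν(A \ D)` with `D` the set of atoms of `ν`. -/
noncomputable def fnu (ν : MeasureTheory.SignedMeasure ℝ) (x : ℝ) : ℝ :=
  Real.exp (-2 * ν (Set.Iic x \ {y : ℝ | ν {y} ≠ 0})) *
    ∏' y : {y : ℝ // ν {y} ≠ 0 ∧ y ≤ x}, (1 - ν {(y : ℝ)}) / (1 + ν {(y : ℝ)})

section

open Filter Topology

lemma signedMeasure_apply_eq_real_sub {α : Type*} [MeasurableSpace α] (ν : SignedMeasure α)
    {A : Set α} (hA : MeasurableSet A) :
    ν A = ν.toJordanDecomposition.posPart.real A - ν.toJordanDecomposition.negPart.real A := by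
  conv_lhs => rw [← ν.toSignedMeasure_toJordanDecomposition]
  rw [JordanDecomposition.toSignedMeasure, Measure.toSignedMeasure_sub_apply hA]

lemma summable_measureReal_singleton {α : Type*} [MeasurableSpace α] [MeasurableSingletonClass α]
    (μ : Measure α) [IsFiniteMeasure μ] : Summable fun a : α => μ.real {a} :=
  ENNReal.summable_toReal <| ne_top_of_le_ne_top (measure_ne_top μ _) <|
    tsum_meas_le_meas_iUnion_of_disjoint μ (fun a => measurableSet_singleton a) fun _ _ h =>
      Set.disjoint_singleton.2 h

lemma summable_signedMeasure_singleton {α : Type*} [MeasurableSpace α]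
    [MeasurableSingletonClass α] (ν : SignedMeasure α) : Summable fun a : α => ν {a} := by
  simp_rw [signedMeasure_apply_eq_real_sub ν (measurableSet_singleton _)]
  exact (summable_measureReal_singleton _).sub (summable_measureReal_singleton _)

lemma measurableSet_signedMeasure_atoms {α : Type*} [MeasurableSpace α]
    [MeasurableSingletonClass α] (ν : SignedMeasure α) : MeasurableSet {a : α | ν {a} ≠ 0} :=
  (summable_signedMeasure_singleton ν).countable_support.measurableSet

lemma tendsto_signedMeasure_of_tendsto_indicator {α ι : Type*} [MeasurableSpace α]
    (ν : SignedMeasure α) {L : Filter ι} [L.IsCountablyGenerated] {s : ι → Set α} {t : Set α}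
    (hs : ∀ i, MeasurableSet (s i)) (ht : MeasurableSet t)
    (h : ∀ a, ∀ᶠ i in L, a ∈ s i ↔ a ∈ t) :
    Tendsto (fun i => ν (s i)) L (𝓝 (ν t)) := by
  simp_rw [signedMeasure_apply_eq_real_sub ν (hs _), signedMeasure_apply_eq_real_sub ν ht]
  have key (μ : Measure α) [IsFiniteMeasure μ] :
      Tendsto (fun i => μ.real (s i)) L (𝓝 (μ.real t)) :=
    (ENNReal.tendsto_toReal (measure_ne_top μ t)).comp
      (tendsto_measure_of_tendsto_indicator_of_isFiniteMeasure L μ hs h)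
  exact (key _).sub (key _)

/-- Sums of a summable family over pointwise convergent index sets converge. -/
lemma Summable.tendsto_tsum_subtype {α ι : Type*} {g : α → ℝ} (hg : Summable g) {L : Filter ι}
    {s : ι → Set α} {t : Set α} (h : ∀ a, ∀ᶠ i in L, a ∈ s i ↔ a ∈ t) :
    Tendsto (fun i => ∑' a : s i, g a) L (𝓝 (∑' a : t, g a)) := by
  simp_rw [tsum_subtype]
  refine tendsto_tsum_of_dominated_convergence hg.norm (fun a => ?_)
    (Eventually.of_forall fun i a => norm_indicator_le_norm_self g a)
  refine tendsto_const_nhds.congr' ?_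
  filter_upwards [h a] with i hi
  by_cases ha : a ∈ t
  · simp [ha, hi.2 ha]
  · simp [ha, mt hi.1 ha]

lemma eventually_le_iff_le_nhdsGE (x y : ℝ) : ∀ᶠ z in 𝓝[≥] x, (y ≤ z ↔ y ≤ x) := by
  rcases le_or_gt y x with h | h
  · filter_upwards [self_mem_nhdsWithin] with z hz
    exact iff_of_true (h.trans hz) h
  · filter_upwards [nhdsWithin_le_nhds (Iio_mem_nhds h)] with z hz
    exact iff_of_false (not_le.2 hz) (not_le.2 h)

lemma summable_log_one_sub_div_one_add {α : Type*} {a : α → ℝ} (ha : Summable a)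
    (h : ∀ i, |a i| < 1) : Summable fun i => Real.log ((1 - a i) / (1 + a i)) := by
  have hsub := (Real.summable_log_one_add_of_summable ha.neg).sub
    (Real.summable_log_one_add_of_summable ha)
  refine hsub.congr fun i => ?_
  obtain ⟨h₁, h₂⟩ := abs_lt.1 (h i)
  rw [Real.log_div (by linarith) (by linarith), sub_eq_add_neg 1 (a i)]

lemma fnu_eq_exp_mul_exp (ν : SignedMeasure ℝ) (hν : ∀ a : ℝ, |ν {a}| < 1) (x : ℝ) :
    fnu ν x = Real.exp (-2 * ν (Set.Iic x \ {y : ℝ | ν {y} ≠ 0})) *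
      Real.exp (∑' y : {y : ℝ | ν {y} ≠ 0 ∧ y ≤ x},
        Real.log ((1 - ν {(y : ℝ)}) / (1 + ν {(y : ℝ)}))) := by
  have hpos (y : ℝ) : 0 < (1 - ν {y}) / (1 + ν {y}) := by
    obtain ⟨h₁, h₂⟩ := abs_lt.1 (hν y)
    exact div_pos (by linarith) (by linarith)
  have hsum := summable_log_one_sub_div_one_add (summable_signedMeasure_singleton ν) hν
  rw [Real.rexp_tsum_eq_tprod (fun y : {y : ℝ | ν {y} ≠ 0 ∧ y ≤ x} => hpos y)
    (hsum.subtype _)]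
  rfl

end

theorem fnu_right_continuous (ν : MeasureTheory.SignedMeasure ℝ)
    (hν : ∀ a : ℝ, |ν {a}| < 1) :
    ∀ x : ℝ, ContinuousWithinAt (fnu ν) (Set.Ici x) x := by
  intro x
  have hsum := summable_log_one_sub_div_one_add (summable_signedMeasure_singleton ν) hν
  have hD := measurableSet_signedMeasure_atoms ν
  rw [ContinuousWithinAt, funext (fnu_eq_exp_mul_exp ν hν)]
  refine Filter.Tendsto.mul ?_ ?_
  · refine (Real.continuous_exp.tendsto _).comp (Filter.Tendsto.const_mul _ ?_)
    refine tendsto_signedMeasure_of_tendsto_indicator ν (fun z => measurableSet_Iic.diff hD)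
      (measurableSet_Iic.diff hD) fun y => ?_
    filter_upwards [eventually_le_iff_le_nhdsGE x y] with z hz
    simp [hz]
  · refine (Real.continuous_exp.tendsto _).comp (hsum.tendsto_tsum_subtype fun y => ?_)
    filter_upwards [eventually_le_iff_le_nhdsGE x y] with z hz
    simp [hz]
end

section
/- Let (E,d) be a metric space with its Borel σ-algebra and let μ be a Borel probability measure on E satisfying T_1(C) for some C > 0. Then for all Borel sets A, B ⊆ E with μ(A) > 0 and μ(B) > 0, the distance d(A,B) := inf{d(a,b) : a ∈ A, b ∈ B} satisfies d(A,B) ≤ √(2C·log(1/μ(A))) + √(2C·log(1/μ(B))). -/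
open MeasureTheory
open scoped ENNReal NNReal

/-- The distance to a set transports along couplings at the cost of the Wasserstein distance
of order one. No separability is needed. -/
lemma lintegral_infEDist_le_add_lintegral_edist {E : Type*} [PseudoEMetricSpace E]
    [MeasurableSpace E] [BorelSpace E] (π : Measure (E × E)) (A : Set E) :
    (∫⁻ x, Metric.infEDist x A ∂π.map Prod.fst ≤
        ∫⁻ x, Metric.infEDist x A ∂π.map Prod.snd + ∫⁻ z, edist z.1 z.2 ∂π) ∧
      (∫⁻ x, Metric.infEDist x A ∂π.map Prod.snd ≤
        ∫⁻ x, Metric.infEDist x A ∂π.map Prod.fst + ∫⁻ z, edist z.1 z.2 ∂π) := by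
  have hg : Measurable fun x : E => Metric.infEDist x A :=
    Metric.continuous_infEDist.measurable
  rw [lintegral_map hg measurable_fst, lintegral_map hg measurable_snd]
  constructor
  · rw [← lintegral_add_left (f := fun z : E × E => Metric.infEDist z.2 A)
      (hg.comp measurable_snd)]
    exact lintegral_mono fun z => Metric.infEDist_le_infEDist_add_edist
  · rw [← lintegral_add_left (f := fun z : E × E => Metric.infEDist z.1 A)
      (hg.comp measurable_fst)]
    refine lintegral_mono fun z => ?_
    dsimp only
    rw [edist_comm]
    exact Metric.infEDist_le_infEDist_add_edist

lemma lintegral_infEDist_le_add_wassersteinDist_one {E : Type*} [PseudoEMetricSpace E]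
    [MeasurableSpace E] [BorelSpace E] (μ ν : Measure E) (A : Set E) :
    (∫⁻ x, Metric.infEDist x A ∂μ ≤
        ∫⁻ x, Metric.infEDist x A ∂ν + wassersteinDist 1 μ ν) ∧
      (∫⁻ x, Metric.infEDist x A ∂ν ≤
        ∫⁻ x, Metric.infEDist x A ∂μ + wassersteinDist 1 μ ν) := by
  simp only [wassersteinDist, ENNReal.rpow_one, div_one, ENNReal.add_iInf, le_iInf_iff]
  constructor
  · rintro π ⟨rfl, rfl⟩
    exact (lintegral_infEDist_le_add_lintegral_edist π A).1
  · rintro π ⟨rfl, rfl⟩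
    exact (lintegral_infEDist_le_add_lintegral_edist π A).2

lemma relEntropy_cond {E : Type*} [MeasurableSpace E] (μ : Measure E) [IsFiniteMeasure μ]
    {A : Set E} (hA : MeasurableSet A) (hμA : μ A ≠ 0) :
    relEntropy (ProbabilityTheory.cond μ A) μ =
      ENNReal.ofReal (Real.log (1 / (μ A).toReal)) := by
  have hac : ProbabilityTheory.cond μ A ≪ μ := ProbabilityTheory.cond_absolutelyContinuous
  have : IsProbabilityMeasure (ProbabilityTheory.cond μ A) :=
    ProbabilityTheory.cond_isProbabilityMeasure hμA
  have hd : (ProbabilityTheory.cond μ A).rnDeriv μ =ᵐ[μ] A.indicator fun _ => (μ A)⁻¹ := by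
    have h : ProbabilityTheory.cond μ A = μ.withDensity (A.indicator fun _ => (μ A)⁻¹) := by
      rw [withDensity_indicator hA, withDensity_const, ProbabilityTheory.cond]
    rw [h]
    exact Measure.rnDeriv_withDensity μ (measurable_const.indicator hA)
  have hlog : (fun x => Real.log ((ProbabilityTheory.cond μ A).rnDeriv μ x).toReal)
      =ᵐ[ProbabilityTheory.cond μ A] fun _ => Real.log (1 / (μ A).toReal) := by
    filter_upwards [hac.ae_le hd, ProbabilityTheory.ae_cond_mem hA] with x hx hxA
    rw [hx, Set.indicator_of_mem hxA, ENNReal.toReal_inv, one_div]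
  rw [relEntropy, if_pos ⟨hac, (integrable_const _).congr hlog.symm⟩, integral_congr_ae hlog]
  simp

lemma SatisfiesTp.wassersteinDist_cond_le {E : Type*} [PseudoEMetricSpace E] [MeasurableSpace E]
    {p C : ℝ} {μ : Measure E} [IsFiniteMeasure μ] (hT : SatisfiesTp p C μ) (hC : 0 ≤ C)
    {A : Set E} (hA : MeasurableSet A) (hμA : μ A ≠ 0) :
    wassersteinDist p μ (ProbabilityTheory.cond μ A) ≤
      ENNReal.ofReal (Real.sqrt (2 * C * Real.log (1 / (μ A).toReal))) := by
  refine (hT _ (ProbabilityTheory.cond_isProbabilityMeasure hμA)).trans_eq ?_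
  rw [relEntropy_cond μ hA hμA, ← ENNReal.ofReal_mul (by positivity), Real.sqrt_eq_rpow]
  obtain h | h := le_total 0 (2 * C * Real.log (1 / (μ A).toReal))
  · exact ENNReal.ofReal_rpow_of_nonneg h (by norm_num)
  · rw [← Real.sqrt_eq_rpow, Real.sqrt_eq_zero_of_nonpos h, ENNReal.ofReal_of_nonpos h]
    simp

theorem T1_distance_between_sets {E : Type*}
    [MetricSpace E] [MeasurableSpace E] [BorelSpace E]
    (μ : Measure E) [IsProbabilityMeasure μ] (C : ℝ) (hC : 0 < C)
    (hT : SatisfiesTp 1 C μ)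
    (A B : Set E) (hA : MeasurableSet A) (hB : MeasurableSet B)
    (hμA : 0 < μ A) (hμB : 0 < μ B) :
    sInf (Set.image2 dist A B) ≤
      Real.sqrt (2 * C * Real.log (1 / (μ A).toReal)) +
        Real.sqrt (2 * C * Real.log (1 / (μ B).toReal)) := by
  have hμA' := hμA.ne'
  have hμB' := hμB.ne'
  have : IsProbabilityMeasure (ProbabilityTheory.cond μ B) :=
    ProbabilityTheory.cond_isProbabilityMeasure hμB'
  have hzero : ∫⁻ x, Metric.infEDist x A ∂(ProbabilityTheory.cond μ A) = 0 := by
    refine lintegral_eq_zero_of_ae_eq_zero ?_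
    filter_upwards [ProbabilityTheory.ae_cond_mem hA] with x hx
    exact Metric.infEDist_zero_of_mem hx
  have hdist : ENNReal.ofReal (sInf (Set.image2 dist A B)) ≤
      ∫⁻ x, Metric.infEDist x A ∂(ProbabilityTheory.cond μ B) := by
    calc ENNReal.ofReal (sInf (Set.image2 dist A B))
        = ∫⁻ _, ENNReal.ofReal (sInf (Set.image2 dist A B)) ∂(ProbabilityTheory.cond μ B) := by
          simp
      _ ≤ _ := by
          refine lintegral_mono_ae ?_
          filter_upwards [ProbabilityTheory.ae_cond_mem hB] with b hb
          refine Metric.le_infEDist.2 fun a ha => ?_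
          rw [edist_comm, edist_dist]
          refine ENNReal.ofReal_le_ofReal (csInf_le ⟨0, ?_⟩ (Set.mem_image2_of_mem ha hb))
          rintro _ ⟨x, _, y, _, rfl⟩
          exact dist_nonneg
  rw [← ENNReal.ofReal_le_ofReal_iff (by positivity),
    ENNReal.ofReal_add (Real.sqrt_nonneg _) (Real.sqrt_nonneg _)]
  calc ENNReal.ofReal (sInf (Set.image2 dist A B))
      ≤ ∫⁻ x, Metric.infEDist x A ∂(ProbabilityTheory.cond μ B) := hdist
    _ ≤ ∫⁻ x, Metric.infEDist x A ∂μ + wassersteinDist 1 μ (ProbabilityTheory.cond μ B) :=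
      (lintegral_infEDist_le_add_wassersteinDist_one _ _ _).2
    _ ≤ wassersteinDist 1 μ (ProbabilityTheory.cond μ A) +
          wassersteinDist 1 μ (ProbabilityTheory.cond μ B) := by
      gcongr
      simpa [hzero] using
        (lintegral_infEDist_le_add_wassersteinDist_one μ (ProbabilityTheory.cond μ A) A).1
    _ ≤ _ := add_le_add (hT.wassersteinDist_cond_le hC.le hA hμA')
      (hT.wassersteinDist_cond_le hC.le hB hμB')
end

section
/- Let (E,d) be a complete separable metric space with its Borel σ-algebra and let μ be a Borel probability measure on E satisfying T_2(C) for some C > 0. Then for every bounded Lipschitz function F : E → ℝ with Lipschitz constant L, ∫ exp( F − ∫ F dμ ) dμ ≤ exp( (C/2)·L² ). -/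
open MeasureTheory
open scoped ENNReal NNReal

/-- One half of Kantorovich duality, per coupling: the difference of the integrals of a Lipschitz
function against the marginals is at most the Lipschitz constant times the quadratic cost. -/
lemma LipschitzWith.ofReal_integral_sub_le_of_coupling {E : Type*} [PseudoEMetricSpace E]
    [SecondCountableTopology E] [MeasurableSpace E] [BorelSpace E] {π : Measure (E × E)}
    [IsProbabilityMeasure π] {F : E → ℝ} {L : ℝ≥0} (hF : LipschitzWith L F)
    (hfst : Integrable F (π.map Prod.fst)) (hsnd : Integrable F (π.map Prod.snd)) :
    ENNReal.ofReal (∫ x, F x ∂(π.map Prod.snd) - ∫ x, F x ∂(π.map Prod.fst)) ≤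
      L * (∫⁻ z, edist z.1 z.2 ^ (2 : ℝ) ∂π) ^ (1 / 2 : ℝ) := by
  have hint : ∫ x, F x ∂(π.map Prod.snd) - ∫ x, F x ∂(π.map Prod.fst) =
      ∫ z, (F z.2 - F z.1) ∂π := by
    rw [integral_map measurable_snd.aemeasurable hsnd.1,
      integral_map measurable_fst.aemeasurable hfst.1]
    exact (integral_sub (hsnd.comp_measurable measurable_snd)
      (hfst.comp_measurable measurable_fst)).symm
  have hmeas : AEMeasurable (fun z : E × E ↦ edist z.1 z.2) π := measurable_edist.aemeasurable
  have hCS : ∫⁻ z, edist z.1 z.2 ∂π ≤ (∫⁻ z, edist z.1 z.2 ^ (2 : ℝ) ∂π) ^ (1 / 2 : ℝ) := by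
    simpa using ENNReal.lintegral_mul_le_Lp_mul_Lq π Real.HolderConjugate.two_two hmeas
      (aemeasurable_const (b := (1 : ℝ≥0∞)))
  calc ENNReal.ofReal (∫ x, F x ∂(π.map Prod.snd) - ∫ x, F x ∂(π.map Prod.fst))
      ≤ ‖∫ z, (F z.2 - F z.1) ∂π‖ₑ := by
        rw [hint, ← ofReal_norm]
        exact ENNReal.ofReal_le_ofReal (Real.le_norm_self _)
    _ ≤ ∫⁻ z, ‖F z.2 - F z.1‖ₑ ∂π := enorm_integral_le_lintegral_enorm _
    _ ≤ ∫⁻ z, L * edist z.1 z.2 ∂π := by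
        refine lintegral_mono fun z ↦ ?_
        rw [← edist_eq_enorm_sub, edist_comm z.1]
        exact hF z.2 z.1
    _ = L * ∫⁻ z, edist z.1 z.2 ∂π := lintegral_const_mul _ measurable_edist
    _ ≤ _ := by gcongr

/-- A Lipschitz function integrates to nearby values against measures close in `W₂`. -/
lemma LipschitzWith.ofReal_integral_sub_le_wassersteinDist {E : Type*} [PseudoEMetricSpace E]
    [SecondCountableTopology E] [MeasurableSpace E] [BorelSpace E] {μ ν : Measure E}
    [IsProbabilityMeasure μ] [IsProbabilityMeasure ν] {F : E → ℝ} {L : ℝ≥0}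
    (hF : LipschitzWith L F) (hμ : Integrable F μ) (hν : Integrable F ν) :
    ENNReal.ofReal (∫ x, F x ∂ν - ∫ x, F x ∂μ) ≤ L * wassersteinDist 2 μ ν := by
  have key : ∀ π ∈ {π : Measure (E × E) | π.map Prod.fst = μ ∧ π.map Prod.snd = ν},
      ENNReal.ofReal (∫ x, F x ∂ν - ∫ x, F x ∂μ) ≤
        L * (∫⁻ z, edist z.1 z.2 ^ (2 : ℝ) ∂π) ^ (1 / 2 : ℝ) := by
    rintro π ⟨rfl, rfl⟩
    have : IsProbabilityMeasure π :=
      (Measure.isProbabilityMeasure_map_iff measurable_fst.aemeasurable).1 ‹_›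
    exact hF.ofReal_integral_sub_le_of_coupling hμ hν
  rcases eq_or_ne L 0 with rfl | hL
  · simpa using key (μ.prod ν) (by simp [Measure.map_fst_prod, Measure.map_snd_prod])
  · rw [mul_comm, ← ENNReal.div_le_iff (by simpa using hL) ENNReal.coe_ne_top]
    refine le_iInf₂ fun π hπ ↦ ?_
    rw [ENNReal.div_le_iff (by simpa using hL) ENNReal.coe_ne_top, mul_comm]
    exact key π hπ

/-- The relative entropy of an exponentially tilted measure. -/
lemma relEntropy_tilted {E : Type*} [MeasurableSpace E] {μ : Measure E} [IsProbabilityMeasure μ]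
    {F : E → ℝ} (hexp : Integrable (fun x ↦ Real.exp (F x)) μ)
    (hF : Integrable F (μ.tilted F)) :
    0 ≤ ∫ x, F x ∂(μ.tilted F) - Real.log (∫ x, Real.exp (F x) ∂μ) ∧
      relEntropy (μ.tilted F) μ =
        ENNReal.ofReal (∫ x, F x ∂(μ.tilted F) - Real.log (∫ x, Real.exp (F x) ∂μ)) := by
  have := isProbabilityMeasure_tilted hexp
  have hac := tilted_absolutelyContinuous μ F
  have hlog := hac.ae_eq (log_rnDeriv_tilted_left_self hexp)
  have hint : Integrable (fun x ↦ Real.log ((μ.tilted F).rnDeriv μ x).toReal) (μ.tilted F) :=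
    (hF.sub (integrable_const _)).congr hlog.symm
  have heq : ∫ x, Real.log ((μ.tilted F).rnDeriv μ x).toReal ∂(μ.tilted F) =
      ∫ x, F x ∂(μ.tilted F) - Real.log (∫ x, Real.exp (F x) ∂μ) := by
    rw [integral_congr_ae hlog, integral_sub hF (integrable_const _)]
    simp
  refine ⟨?_, by rw [relEntropy, if_pos ⟨hac, hint⟩, heq]⟩
  simpa [llr, heq] using InformationTheory.integral_llr_add_sub_measure_univ_nonneg hac hint

theorem T2_exp_concentration {E : Type*} [MetricSpace E] [CompleteSpace E]
    [TopologicalSpace.SeparableSpace E] [MeasurableSpace E] [BorelSpace E]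
    (μ : Measure E) [IsProbabilityMeasure μ] (C : ℝ) (hC : 0 < C)
    (hT : SatisfiesTp 2 C μ)
    (F : E → ℝ) (L : ℝ≥0) (hF : LipschitzWith L F) (hbdd : ∃ M, ∀ x, |F x| ≤ M) :
    ∫ x, Real.exp (F x - ∫ y, F y ∂μ) ∂μ ≤ Real.exp (C / 2 * (L : ℝ) ^ 2) := by
  obtain ⟨M, hM⟩ := hbdd
  have : SecondCountableTopology E := UniformSpace.secondCountable_of_separable E
  have hFi (ν : Measure E) [IsProbabilityMeasure ν] : Integrable F ν :=
    .of_bound hF.continuous.aestronglyMeasurable M (.of_forall hM)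
  have hexp : Integrable (fun x ↦ Real.exp (F x)) μ :=
    .of_bound (Real.continuous_exp.comp hF.continuous).aestronglyMeasurable (Real.exp M)
      (.of_forall fun x ↦ by
        simpa using (le_abs_self _).trans (hM x))
  have hν := isProbabilityMeasure_tilted hexp
  obtain ⟨hH, hent⟩ := relEntropy_tilted hexp (hFi _)
  have hW := hT _ hν
  have hdual := hF.ofReal_integral_sub_le_wassersteinDist (hFi μ) (hFi (μ.tilted F))
  have hpos : 0 < ∫ x, Real.exp (F x) ∂μ := integral_exp_pos hexp
  set H := ∫ x, F x ∂(μ.tilted F) - Real.log (∫ x, Real.exp (F x) ∂μ) with hHdef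
  have hmean : ∫ x, F x ∂(μ.tilted F) - ∫ x, F x ∂μ ≤ L * √(2 * C * H) := by
    rw [← ENNReal.ofReal_le_ofReal_iff (by positivity)]
    refine hdual.trans ((mul_le_mul_right hW _).trans_eq ?_)
    rw [hent, ← ENNReal.ofReal_mul (by positivity), ENNReal.ofReal_rpow_of_nonneg (by positivity)
      (by positivity), ← Real.sqrt_eq_rpow, ENNReal.ofReal_mul (by positivity),
      ENNReal.ofReal_coe_nnreal]
  have hyoung : L * √(2 * C * H) ≤ C / 2 * (L : ℝ) ^ 2 + H := by
    rw [Real.sqrt_mul (by positivity)]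
    have h1 := Real.sq_sqrt (by positivity : 0 ≤ 2 * C)
    have h2 := Real.sq_sqrt hH
    nlinarith [sq_nonneg (L * √(2 * C) / 2 - √H)]
  simp_rw [Real.exp_sub, integral_div]
  rw [← Real.exp_log hpos, ← Real.exp_sub, Real.exp_le_exp]
  linarith
end
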